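/- Fine's second transformation: ∑_{n≥0} (q;q)_n (aq;q)_n z^n / ((q;q)_n (bq;q)_n) = (1/(1-z)) ∑_{n≥0} (b/a;q)_n (-az)^n q^{n(n+1)/2} / ((bq;q)_n (zq;q)_n), as formal power series (equivalently, the identity ₂φ₁(q, aq; bq; q, z) = (1/(1-z)) ∑_{n≥0} (b/a;q)_n (-az)^n q^{n(n+1)/2} / ((bq;q)_n (zq;q)_n)). -/

import Mathlib

open Finset Filter Topology

namespace FineTransformation

/-- The `q`-Pochhammer symbol `(xq; q)_n`. -/
noncomputable def qPoch (q x : ℂ) (n : ℕ) : ℂ := ∏ k ∈ range n, (1 - x * q ^ (k + 1))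

lemma qPoch_succ (q x : ℂ) (n : ℕ) :
    qPoch q x (n + 1) = qPoch q x n * (1 - x * q ^ (n + 1)) := prod_range_succ _ _

lemma summable_norm_mul_pow_succ {q : ℂ} (hq : ‖q‖ < 1) (x : ℂ) :
    Summable fun k : ℕ => ‖-(x * q ^ (k + 1))‖ := by
  have h := ((summable_nat_add_iff 1).2 (summable_geometric_of_lt_one (norm_nonneg q) hq)).mul_left
    ‖x‖
  simpa [norm_mul, norm_pow] using h

lemma tendsto_qPoch {q : ℂ} (hq : ‖q‖ < 1) (x : ℂ) :
    Tendsto (qPoch q x) atTop (𝓝 (∏' k : ℕ, (1 + -(x * q ^ (k + 1))))) := by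
  have h := (multipliable_one_add_of_summable
    (summable_norm_mul_pow_succ hq x)).tendsto_prod_tprod_nat
  simp only [← sub_eq_add_neg] at h ⊢
  exact h

lemma exists_norm_le_of_tendsto {u : ℕ → ℂ} {l : ℂ} (h : Tendsto u atTop (𝓝 l)) :
    ∃ C, ∀ n, ‖u n‖ ≤ C := by
  obtain ⟨C, hC⟩ := (Metric.isBounded_range_of_tendsto u h).exists_norm_le
  exact ⟨C, fun n => hC _ ⟨n, rfl⟩⟩

lemma exists_norm_qPoch_le {q : ℂ} (hq : ‖q‖ < 1) (x : ℂ) : ∃ C, ∀ n, ‖qPoch q x n‖ ≤ C :=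
  exists_norm_le_of_tendsto (tendsto_qPoch hq x)

lemma exists_norm_inv_qPoch_le {q : ℂ} (hq : ‖q‖ < 1) {x : ℂ} (hx : ∀ n, qPoch q x n ≠ 0) :
    ∃ C, ∀ n, ‖(qPoch q x n)⁻¹‖ ≤ C := by
  refine exists_norm_le_of_tendsto ((tendsto_qPoch hq x).inv₀ ?_)
  refine tprod_one_add_ne_zero_of_summable (fun k => ?_) (summable_norm_mul_pow_succ hq x)
  have h := hx (k + 1)
  rw [qPoch_succ] at h
  rw [← sub_eq_add_neg]
  exact right_ne_zero_of_mul h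

/-- The shifted series `∑ (aq; q)_n (z q^N)^n / (bq; q)_{N + n}`, which satisfies a first-order
recurrence in `N`. -/
noncomputable def shiftedSeries (a b z q : ℂ) (N : ℕ) : ℂ :=
  ∑' n : ℕ, qPoch q a n * (z * q ^ N) ^ n * (qPoch q b (N + n))⁻¹

lemma exists_norm_shiftedSeries_term_le {b q : ℂ} (a z : ℂ) (hq : ‖q‖ < 1)
    (hb : ∀ n, qPoch q b n ≠ 0) :
    ∃ C, ∀ N n : ℕ, ‖qPoch q a n * (z * q ^ N) ^ n * (qPoch q b (N + n))⁻¹‖ ≤ C * ‖z‖ ^ n := by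
  obtain ⟨A, hA⟩ := exists_norm_qPoch_le hq a
  obtain ⟨B, hB⟩ := exists_norm_inv_qPoch_le hq hb
  have hA0 : 0 ≤ A := (norm_nonneg _).trans (hA 0)
  refine ⟨A * B, fun N n => ?_⟩
  have hz : ‖(z * q ^ N) ^ n‖ ≤ ‖z‖ ^ n := by
    rw [norm_pow, norm_mul, norm_pow]
    gcongr
    exact mul_le_of_le_one_right (norm_nonneg _) (pow_le_one₀ (norm_nonneg _) hq.le)
  rw [norm_mul, norm_mul, mul_right_comm A]
  gcongr
  · exact hA n
  · exact hB _

lemma summable_shiftedSeries {b z q : ℂ} (a : ℂ) (hq : ‖q‖ < 1) (hz : ‖z‖ < 1)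
    (hb : ∀ n, qPoch q b n ≠ 0) (N : ℕ) :
    Summable fun n : ℕ => qPoch q a n * (z * q ^ N) ^ n * (qPoch q b (N + n))⁻¹ := by
  obtain ⟨C, hC⟩ := exists_norm_shiftedSeries_term_le a z hq hb
  exact .of_norm_bounded ((summable_geometric_of_lt_one (norm_nonneg z) hz).mul_left C) (hC N)

lemma exists_norm_shiftedSeries_le {b z q : ℂ} (a : ℂ) (hq : ‖q‖ < 1) (hz : ‖z‖ < 1)
    (hb : ∀ n, qPoch q b n ≠ 0) : ∃ C, ∀ N, ‖shiftedSeries a b z q N‖ ≤ C := by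
  obtain ⟨C, hC⟩ := exists_norm_shiftedSeries_term_le a z hq hb
  exact ⟨_, fun N => tsum_of_norm_bounded
    ((summable_geometric_of_lt_one (norm_nonneg z) hz).mul_left C).hasSum (hC N)⟩

lemma shiftedSeries_recurrence {b z q : ℂ} (a : ℂ) (hq : ‖q‖ < 1) (hz : ‖z‖ < 1)
    (hb : ∀ n, qPoch q b n ≠ 0) (N : ℕ) :
    (1 - z * q ^ N) * shiftedSeries a b z q N =
      (qPoch q b N)⁻¹ + z * q ^ (N + 1) * (b * q ^ N - a) * shiftedSeries a b z q (N + 1) := by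
  have hs := summable_shiftedSeries a hq hz hb N
  have hs' := (summable_nat_add_iff 1).2 hs
  have hzero : shiftedSeries a b z q N = (qPoch q b N)⁻¹ +
      ∑' n : ℕ, qPoch q a (n + 1) * (z * q ^ N) ^ (n + 1) * (qPoch q b (N + (n + 1)))⁻¹ := by
    rw [shiftedSeries, hs.tsum_eq_zero_add]
    simp [qPoch]
  rw [sub_mul, one_mul]
  nth_rewrite 1 [hzero]
  rw [add_sub_assoc, shiftedSeries, shiftedSeries, ← tsum_mul_left, ← tsum_mul_left,
    ← hs'.tsum_sub (hs.mul_left _)]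
  congr 1
  refine tsum_congr fun n => ?_
  have h1 := hb (N + n)
  have h2 := hb (N + n + 1)
  rw [qPoch_succ] at h2
  have h3 := right_ne_zero_of_mul h2
  rw [show N + 1 + n = N + n + 1 by ring, ← add_assoc, qPoch_succ, qPoch_succ]
  field_simp
  ring

/-- The coefficients `(b/a; q)_n (-az)^n q^{n(n+1)/2} / (zq; q)_n`. -/
noncomputable def fineCoeff (a b z q : ℂ) (n : ℕ) : ℂ :=
  (∏ k ∈ range n, (1 - b / a * q ^ k)) * (-(a * z)) ^ n * q ^ (n * (n + 1) / 2) *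
    (qPoch q z n)⁻¹

lemma fineCoeff_succ {a : ℂ} (b z q : ℂ) (ha : a ≠ 0) (n : ℕ) :
    fineCoeff a b z q (n + 1) =
      z * q ^ (n + 1) * (b * q ^ n - a) * (1 - z * q ^ (n + 1))⁻¹ * fineCoeff a b z q n := by
  have h : (n + 1) * (n + 1 + 1) / 2 = n * (n + 1) / 2 + (n + 1) := by
    rw [show (n + 1) * (n + 1 + 1) = n * (n + 1) + (n + 1) * 2 by ring,
      Nat.add_mul_div_right _ _ two_pos]
  have h' : (1 - b / a * q ^ n) * -a = b * q ^ n - a := by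
    field_simp
    ring
  rw [fineCoeff, fineCoeff, h, prod_range_succ, qPoch_succ, mul_inv, ← h', pow_succ, pow_add q]
  ring

lemma summable_norm_fineCoeff {a q : ℂ} (b z : ℂ) (ha : a ≠ 0) (hq : ‖q‖ < 1) :
    Summable fun n => ‖fineCoeff a b z q n‖ := by
  have hp : Tendsto (fun n : ℕ => q ^ n) atTop (𝓝 0) := tendsto_pow_atTop_nhds_zero_of_norm_lt_one hq
  have hp' := (tendsto_add_atTop_iff_nat 1).2 hp
  have hlim : Tendsto (fun n : ℕ => z * q ^ (n + 1) * (b * q ^ n - a) *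
      (1 - z * q ^ (n + 1))⁻¹) atTop (𝓝 (z * 0 * (b * 0 - a) * (1 - z * 0)⁻¹)) :=
    ((hp'.const_mul z).mul ((hp.const_mul b).sub_const a)).mul
      (((hp'.const_mul z).const_sub 1).inv₀ (by simp))
  have hev := hlim.norm.eventually_le_const (u := 1 / 2) (by simp)
  refine summable_of_ratio_norm_eventually_le (r := 1 / 2) (by norm_num) ?_
  filter_upwards [hev] with n hn
  rw [fineCoeff_succ b z q ha, norm_norm, norm_norm, norm_mul]
  gcongr

lemma hasSum_fineCoeff {a b z q : ℂ} (hq : ‖q‖ < 1) (hz : ‖z‖ < 1) (ha : a ≠ 0)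
    (hb : ∀ n, qPoch q b n ≠ 0) (hzq : ∀ n, qPoch q z n ≠ 0) :
    HasSum (fun n => fineCoeff a b z q n * (qPoch q b n)⁻¹)
      ((1 - z) * shiftedSeries a b z q 0) := by
  have hc := summable_norm_fineCoeff b z ha hq
  obtain ⟨B, hB⟩ := exists_norm_inv_qPoch_le hq hb
  obtain ⟨H, hH⟩ := exists_norm_shiftedSeries_le a hq hz hb
  have hs : Summable fun n => fineCoeff a b z q n * (qPoch q b n)⁻¹ := by
    refine .of_norm_bounded (hc.mul_right B) fun n => ?_
    rw [norm_mul]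
    gcongr
    exact hB n
  have hpart (N : ℕ) : ∑ n ∈ range N, fineCoeff a b z q n * (qPoch q b n)⁻¹ =
      (1 - z) * shiftedSeries a b z q 0 -
        fineCoeff a b z q N * ((1 - z * q ^ N) * shiftedSeries a b z q N) := by
    induction N with
    | zero => simp [fineCoeff, qPoch]
    | succ N ih =>
      have h := hzq (N + 1)
      rw [qPoch_succ] at h
      have h' := right_ne_zero_of_mul h
      rw [sum_range_succ, ih, shiftedSeries_recurrence a hq hz hb N, fineCoeff_succ b z q ha]
      field_simp
      ring
  have hrem : Tendsto (fun N => fineCoeff a b z q N *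
      ((1 - z * q ^ N) * shiftedSeries a b z q N)) atTop (𝓝 0) := by
    refine squeeze_zero_norm (a := fun N => ‖fineCoeff a b z q N‖ * (2 * H)) (fun N => ?_) ?_
    · rw [norm_mul, norm_mul]
      have h2 : ‖1 - z * q ^ N‖ ≤ 2 := by
        have hle : ‖z * q ^ N‖ ≤ 1 := by
          rw [norm_mul, norm_pow]
          exact mul_le_one₀ hz.le (by positivity) (pow_le_one₀ (norm_nonneg _) hq.le)
        have := norm_sub_le 1 (z * q ^ N)
        rw [norm_one] at this
        linarith
      gcongr
      exact hH N
    · simpa using hc.tendsto_atTop_zero.mul_const (2 * H)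
  refine (hs.hasSum_iff_tendsto_nat).2 ?_
  simp_rw [hpart]
  simpa using hrem.const_sub ((1 - z) * shiftedSeries a b z q 0)

end FineTransformation

open FineTransformation
/-- Fine's second transformation:
`₂φ₁(q, aq; bq; q, z) = (1/(1-z)) ∑_{n≥0} (b/a;q)_n (-az)^n q^{n(n+1)/2} / ((bq;q)_n (zq;q)_n)`,
for complex parameters with `|q| < 1`, `|z| < 1`, `a ≠ 0`, and nonvanishing denominators. -/
theorem stmt_12 (a b z q : ℂ) (hq : ‖q‖ < 1) (hz : ‖z‖ < 1) (ha : a ≠ 0)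
    (hz1 : z ≠ 1)
    (hqq : ∀ n : ℕ, ∏ k ∈ Finset.range n, (1 - q ^ (k + 1)) ≠ 0)
    (hbq : ∀ n : ℕ, ∏ k ∈ Finset.range n, (1 - b * q ^ (k + 1)) ≠ 0)
    (hzq : ∀ n : ℕ, ∏ k ∈ Finset.range n, (1 - z * q ^ (k + 1)) ≠ 0) :
    ∑' n : ℕ, (∏ k ∈ Finset.range n, (1 - q ^ (k + 1))) *
        (∏ k ∈ Finset.range n, (1 - a * q ^ (k + 1))) * z ^ n /
        ((∏ k ∈ Finset.range n, (1 - q ^ (k + 1))) *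
          ∏ k ∈ Finset.range n, (1 - b * q ^ (k + 1)))
      = (1 - z)⁻¹ *
        ∑' n : ℕ, (∏ k ∈ Finset.range n, (1 - b / a * q ^ k)) * (-(a * z)) ^ n *
          q ^ (n * (n + 1) / 2) /
          ((∏ k ∈ Finset.range n, (1 - b * q ^ (k + 1))) *
            ∏ k ∈ Finset.range n, (1 - z * q ^ (k + 1))) := by
  have h := hasSum_fineCoeff hq hz ha hbq hzq
  have hl : shiftedSeries a b z q 0 = ∑' n : ℕ, (∏ k ∈ Finset.range n, (1 - q ^ (k + 1))) *
        (∏ k ∈ Finset.range n, (1 - a * q ^ (k + 1))) * z ^ n /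
        ((∏ k ∈ Finset.range n, (1 - q ^ (k + 1))) *
          ∏ k ∈ Finset.range n, (1 - b * q ^ (k + 1))) := by
    refine tsum_congr fun n => ?_
    rw [mul_assoc (∏ k ∈ Finset.range n, (1 - q ^ (k + 1))), mul_div_mul_left _ _ (hqq n),
      pow_zero, mul_one, zero_add, div_eq_mul_inv]
    rfl
  rw [← hl, eq_inv_mul_iff_mul_eq₀ (sub_ne_zero.2 hz1.symm), ← h.tsum_eq]
  refine tsum_congr fun n => ?_
  rw [div_eq_mul_inv, mul_inv_rev, ← mul_assoc]
  rfl
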